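/- arXiv:1903.02999 — 13 statements merged into one kernel-verified Lean document; each statement's English description precedes it below -/
import Mathlib

section
/- Let G = (V, E, w, s) be a finite directed graph where each edge e = (u, v) carries a capacity w(e) ∈ [0, ∞] and an integer shift s(e) ∈ ℤ. Define A(G) as the infimum, over all rank assignments r : V → ℤ, of Σ_{e=(u,v)∈E} w(e)·max(r(u) − r(v) + s(e), 0) (with the convention ∞·0 = 0), and define C(G) as the supremum, over all circulations f : E → ℝ≥0 satisfying f(e) ≤ w(e) whenever w(e) < ∞ and, for every vertex v, Σ_{e=(x,v)∈E} f(e) = Σ_{e=(v,x)∈E} f(e), of Σ_{e∈E} s(e)·f(e). Then A(G) = C(G), as values in [0, ∞]. -/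
open scoped ENNReal

/-- A finite family of difference constraints `r a + n ≤ r b` has an integer solution as soon as
it is contained in a relation closed under composition all of whose loops have nonpositive
weight. -/
theorem exists_int_potential {V : Type*} [DecidableEq V] (D : V → V → ℤ → Prop)
    (hcomp : ∀ a b c n m, D a b n → D b c m → D a c (n + m))
    (hloop : ∀ a n, D a a n → n ≤ 0) (S : Finset V) (T : Finset (V × V × ℤ))
    (hT : ∀ t ∈ T, t.1 ∈ S ∧ t.2.1 ∈ S ∧ D t.1 t.2.1 t.2.2) :
    ∃ r : V → ℤ, ∀ t ∈ T, r t.1 + t.2.2 ≤ r t.2.1 := by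
  induction S using Finset.induction_on generalizing T with
  | empty => exact ⟨0, fun t ht => absurd (hT t ht).1 (Finset.notMem_empty _)⟩
  | insert x S hx ih =>
    let I := T.filter fun t => t.1 ≠ x ∧ t.2.1 = x
    let O := T.filter fun t => t.1 = x ∧ t.2.1 ≠ x
    let T' := (T.filter fun t => t.1 ≠ x ∧ t.2.1 ≠ x) ∪
      (I ×ˢ O).image fun q => (q.1.1, q.2.2.1, q.1.2.2 + q.2.2.2)
    obtain ⟨r, hr⟩ := ih T' (by
      intro t ht
      rcases Finset.mem_union.1 ht with ht | ht
      · obtain ⟨ht, h1, h2⟩ := Finset.mem_filter.1 ht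
        obtain ⟨h3, h4, h5⟩ := hT t ht
        exact ⟨Finset.mem_of_mem_insert_of_ne h3 h1, Finset.mem_of_mem_insert_of_ne h4 h2, h5⟩
      · obtain ⟨⟨i, o⟩, hq, rfl⟩ := Finset.mem_image.1 ht
        obtain ⟨hi, ho⟩ := Finset.mem_product.1 hq
        obtain ⟨hi, hi1, hi2⟩ := Finset.mem_filter.1 hi
        obtain ⟨ho, ho1, ho2⟩ := Finset.mem_filter.1 ho
        obtain ⟨h3, -, h5⟩ := hT i hi
        obtain ⟨-, h4, h6⟩ := hT o ho
        simp only at hi1 hi2 ho1 ho2 h3 h4 h5 h6 ⊢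
        refine ⟨Finset.mem_of_mem_insert_of_ne h3 hi1, Finset.mem_of_mem_insert_of_ne h4 ho2, ?_⟩
        rw [hi2] at h5
        rw [ho1] at h6
        exact hcomp _ _ _ _ _ h5 h6)
    have hmid : ∀ i ∈ I, ∀ o ∈ O, r i.1 + i.2.2 ≤ r o.2.1 - o.2.2 := by
      intro i hi o ho
      have := hr (i.1, o.2.1, i.2.2 + o.2.2) (Finset.mem_union_right _
        (Finset.mem_image.2 ⟨(i, o), Finset.mem_product.2 ⟨hi, ho⟩, rfl⟩))
      simp only at this
      omega
    obtain ⟨z, hzI, hzO⟩ : ∃ z : ℤ, (∀ i ∈ I, r i.1 + i.2.2 ≤ z) ∧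
        ∀ o ∈ O, z ≤ r o.2.1 - o.2.2 := by
      rcases I.eq_empty_or_nonempty with hI | hI
      · rcases O.eq_empty_or_nonempty with hO | hO
        · exact ⟨0, by simp [hI], by simp [hO]⟩
        · obtain ⟨o, ho, hmin⟩ := O.exists_min_image (fun o => r o.2.1 - o.2.2) hO
          exact ⟨_, by simp [hI], hmin⟩
      · obtain ⟨i, hi, hmax⟩ := I.exists_max_image (fun i => r i.1 + i.2.2) hI
        exact ⟨_, hmax, hmid i hi⟩
    refine ⟨Function.update r x z, fun t ht => ?_⟩
    by_cases h1 : t.1 = x <;> by_cases h2 : t.2.1 = x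
    · have h := (hT t ht).2.2
      rw [h1, h2] at h
      have := hloop _ _ h
      rw [h1, h2]
      omega
    · have := hzO t (Finset.mem_filter.2 ⟨ht, h1, h2⟩)
      rw [h1, Function.update_self, Function.update_of_ne h2]
      omega
    · have := hzI t (Finset.mem_filter.2 ⟨ht, h1, h2⟩)
      rw [h2, Function.update_self, Function.update_of_ne h1]
      exact this
    · rw [Function.update_of_ne h1, Function.update_of_ne h2]
      exact hr t (Finset.mem_union_left _ (Finset.mem_filter.2 ⟨ht, h1, h2⟩))

/-- Flow conservation is orthogonality to all potential differences. -/
theorem conservation_iff_forall_potential {V : Type*} [Fintype V] [DecidableEq V]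
    (E : Finset (V × V)) (f : V × V → ℝ) :
    (∀ v : V, (∑ e ∈ E.filter (fun e => e.2 = v), f e) = ∑ e ∈ E.filter (fun e => e.1 = v), f e) ↔
      ∀ p : V → ℝ, ∑ e ∈ E, f e * (p e.2 - p e.1) = 0 := by
  constructor
  · intro h p
    have key (π : V × V → V) :
        ∑ e ∈ E, f e * p (π e) = ∑ v, (∑ e ∈ E.filter (fun e => π e = v), f e) * p v := by
      rw [← Finset.sum_fiberwise E π]
      refine Finset.sum_congr rfl fun v _ => ?_
      rw [Finset.sum_mul]
      exact Finset.sum_congr rfl fun e he => by rw [(Finset.mem_filter.1 he).2]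
    simp only [mul_sub, Finset.sum_sub_distrib]
    rw [key Prod.snd, key Prod.fst, sub_eq_zero]
    exact Finset.sum_congr rfl fun v _ => by rw [h v]
  · intro h v
    have := h (fun u => if u = v then 1 else 0)
    simpa [mul_sub, Finset.sum_sub_distrib, sub_eq_zero, Finset.sum_filter] using this

/-- A direction which increases only unsaturated coordinates and decreases only positive ones
can be followed for a positive time inside a box. -/
theorem exists_pos_add_mul_mem_Icc {ι : Type*} [Finite ι] {f g c : ι → ℝ}
    (hf : f ∈ Set.Icc 0 c) (h0 : ∀ i, f i = 0 → 0 ≤ g i) (hc : ∀ i, f i = c i → g i ≤ 0) :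
    ∃ ε : ℝ, 0 < ε ∧ f + ε • g ∈ Set.Icc 0 c := by
  have hcont (i : ι) : Filter.Tendsto (fun ε : ℝ => f i + ε * g i)
      (nhdsWithin 0 (Set.Ioi 0)) (nhds (f i)) := by
    have : Continuous fun ε : ℝ => f i + ε * g i := by fun_prop
    simpa using (this.tendsto 0).mono_left nhdsWithin_le_nhds
  have hev : ∀ᶠ ε : ℝ in nhdsWithin 0 (Set.Ioi 0),
      ∀ i, 0 ≤ f i + ε * g i ∧ f i + ε * g i ≤ c i := by
    refine Filter.eventually_all.2 fun i => Filter.Eventually.and ?_ ?_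
    · rcases (hf.1 i).eq_or_lt with h | h
      · filter_upwards [self_mem_nhdsWithin] with ε hε
        have hε : 0 < ε := hε
        have h : f i = 0 := h.symm
        have := h0 i h
        rw [h]
        positivity
      · exact ((hcont i).eventually (lt_mem_nhds h)).mono fun _ => le_of_lt
    · rcases (hf.2 i).eq_or_lt with h | h
      · filter_upwards [self_mem_nhdsWithin] with ε hε
        have := mul_nonpos_of_nonneg_of_nonpos (le_of_lt hε) (hc i h)
        linarith
      · exact ((hcont i).eventually (gt_mem_nhds h)).mono fun _ => le_of_lt
  obtain ⟨ε, hε, hpos⟩ := (hev.and self_mem_nhdsWithin).exists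
  exact ⟨ε, hpos, fun i => (hε i).1, fun i => (hε i).2⟩

/-- For finite capacities some circulation and some integer rank assignment have equal value. -/
theorem exists_circulation_rank_eq {V : Type*} [Fintype V] [DecidableEq V]
    (E : Finset (V × V)) (c : V × V → ℝ) (hc : 0 ≤ c) (s : V × V → ℤ) :
    ∃ f ∈ Set.Icc 0 c, (∀ p : V → ℝ, ∑ e ∈ E, f e * (p e.2 - p e.1) = 0) ∧
      ∃ r : V → ℤ, ∑ e ∈ E, c e * ((max (r e.1 - r e.2 + s e) 0 : ℤ) : ℝ) =
        ∑ e ∈ E, (s e : ℝ) * f e := by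
  let K : Set (V × V → ℝ) :=
    Set.Icc 0 c ∩ {f | ∀ p : V → ℝ, ∑ e ∈ E, f e * (p e.2 - p e.1) = 0}
  have hK : IsCompact K := by
    refine isCompact_Icc.inter_right ?_
    simp only [Set.ofPred_forall]
    exact isClosed_iInter fun p => isClosed_eq (by fun_prop) continuous_const
  have hne : K.Nonempty := ⟨0, ⟨le_rfl, hc⟩, fun p => by simp⟩
  obtain ⟨f, ⟨hf, hcirc⟩, hmax⟩ := hK.exists_isMaxOn hne
    (f := fun f => ∑ e ∈ E, (s e : ℝ) * f e) (by fun_prop)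
  refine ⟨f, hf, hcirc, ?_⟩
  let D : V → V → ℤ → Prop := fun a b n => ∃ g : V × V → ℝ,
    (∀ e, f e = 0 → 0 ≤ g e) ∧ (∀ e, f e = c e → g e ≤ 0) ∧
    (∀ p : V → ℝ, ∑ e ∈ E, g e * (p e.2 - p e.1) = p b - p a) ∧
    ∑ e ∈ E, (s e : ℝ) * g e = n
  have hcomp : ∀ a b d n m, D a b n → D b d m → D a d (n + m) := by
    rintro a b d n m ⟨g, g1, g2, g3, g4⟩ ⟨h, h1, h2, h3, h4⟩
    refine ⟨g + h, fun e he => add_nonneg (g1 e he) (h1 e he),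
      fun e he => add_nonpos (g2 e he) (h2 e he), fun p => ?_, ?_⟩
    · simp only [Pi.add_apply, add_mul, Finset.sum_add_distrib, g3, h3]
      ring
    · simp only [Pi.add_apply, mul_add, Finset.sum_add_distrib, g4, h4]
      push_cast
      ring
  have hloop : ∀ a n, D a a n → n ≤ 0 := by
    rintro a n ⟨g, g1, g2, g3, g4⟩
    obtain ⟨ε, hε, hmem⟩ := exists_pos_add_mul_mem_Icc hf g1 g2
    have hcirc' : ∀ p : V → ℝ, ∑ e ∈ E, (f + ε • g) e * (p e.2 - p e.1) = 0 := by
      intro p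
      simp only [Pi.add_apply, Pi.smul_apply, smul_eq_mul, add_mul, Finset.sum_add_distrib,
        hcirc p, mul_assoc, ← Finset.mul_sum, g3 p]
      simp
    have hle : ∑ e ∈ E, (s e : ℝ) * (f + ε • g) e ≤ ∑ e ∈ E, (s e : ℝ) * f e :=
      hmax ⟨hmem, hcirc'⟩
    have hval : ∑ e ∈ E, (s e : ℝ) * (f + ε • g) e = ∑ e ∈ E, (s e : ℝ) * f e + ε * n := by
      rw [← g4, Finset.mul_sum, ← Finset.sum_add_distrib]
      refine Finset.sum_congr rfl fun e _ => ?_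
      simp only [Pi.add_apply, Pi.smul_apply, smul_eq_mul]
      ring
    have : ε * (n : ℝ) ≤ 0 := by linarith
    exact_mod_cast nonpos_of_mul_nonpos_right this hε
  have hsingle : ∀ e e' : V × V, 0 ≤ (Pi.single e 1 : V × V → ℝ) e' := by
    intro e e'
    rw [Pi.single_apply]
    split_ifs <;> norm_num
  have hfwd : ∀ e ∈ E, f e < c e → D e.1 e.2 (s e) := by
    intro e he hlt
    refine ⟨Pi.single e 1, fun e' _ => hsingle e e', fun e' he' => ?_,
      fun p => ?_, ?_⟩
    · rw [Pi.single_eq_of_ne]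
      rintro rfl
      exact hlt.ne he'
    · simp [Pi.single_apply, he]
    · simp [Pi.single_apply, he]
  have hbwd : ∀ e ∈ E, 0 < f e → D e.2 e.1 (-s e) := by
    intro e he hlt
    refine ⟨-Pi.single e 1, fun e' he' => ?_,
      fun e' _ => neg_nonpos.2 (hsingle e e'), fun p => ?_, ?_⟩
    · rw [Pi.neg_apply, Pi.single_eq_of_ne, neg_zero]
      rintro rfl
      exact hlt.ne' he'
    · simp [Pi.single_apply, he]
    · simp [Pi.single_apply, he]
  classical
  obtain ⟨r, hr⟩ := exists_int_potential D hcomp hloop Finset.univ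
    ((E.filter fun e => f e < c e).image (fun e => (e.1, e.2, s e)) ∪
      (E.filter fun e => 0 < f e).image (fun e => (e.2, e.1, -s e))) (by
    intro t ht
    refine ⟨Finset.mem_univ _, Finset.mem_univ _, ?_⟩
    rcases Finset.mem_union.1 ht with ht | ht <;>
      obtain ⟨e, he, rfl⟩ := Finset.mem_image.1 ht <;>
      obtain ⟨he, hlt⟩ := Finset.mem_filter.1 he
    · exact hfwd e he hlt
    · exact hbwd e he hlt)
  have hslack : ∀ e ∈ E, c e * ((max (r e.1 - r e.2 + s e) 0 : ℤ) : ℝ) =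
      (s e : ℝ) * f e - f e * ((r e.2 : ℝ) - r e.1) := by
    intro e he
    have key : c e * ((max (r e.1 - r e.2 + s e) 0 : ℤ) : ℝ) =
        f e * ((r e.1 - r e.2 + s e : ℤ) : ℝ) := by
      have h1 : f e < c e → r e.1 + s e ≤ r e.2 := fun h =>
        hr (e.1, e.2, s e) (Finset.mem_union_left _
          (Finset.mem_image.2 ⟨e, Finset.mem_filter.2 ⟨he, h⟩, rfl⟩))
      have h2 : 0 < f e → r e.2 + -s e ≤ r e.1 := fun h =>
        hr (e.2, e.1, -s e) (Finset.mem_union_right _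
          (Finset.mem_image.2 ⟨e, Finset.mem_filter.2 ⟨he, h⟩, rfl⟩))
      have hf0 : 0 ≤ f e := hf.1 e
      rcases (hf.2 e).eq_or_lt with h | h
      · rcases hf0.eq_or_lt with h' | h'
        · rw [← h, ← h', zero_mul, zero_mul]
        · rw [h, max_eq_left (by have := h2 h'; omega)]
      · rw [max_eq_right (by have := h1 h; omega)]
        rcases hf0.eq_or_lt with h' | h'
        · rw [← h', Int.cast_zero, mul_zero, zero_mul]
        · rw [show r e.1 - r e.2 + s e = 0 by have := h1 h; have := h2 h'; omega]
          simp
    rw [key]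
    push_cast
    ring
  refine ⟨r, ?_⟩
  rw [Finset.sum_congr rfl hslack, Finset.sum_sub_distrib, hcirc fun v => (r v : ℝ), sub_zero]

/-- The positive part of an integer has the same value through `ℕ` and through `ℝ`. -/
theorem natCast_toNat_max_zero (t : ℤ) :
    (((max t 0).toNat : ℕ) : ℝ≥0∞) = ENNReal.ofReal ((max t 0 : ℤ) : ℝ) := by
  rw [← ENNReal.ofReal_natCast]
  congr 1
  exact_mod_cast Int.toNat_of_nonneg (le_max_right t 0)

/-- for a finite directed graph with capacities `w : E → [0, ∞]` and
integer shifts `s : E → ℤ`, the infimum over rank assignments `r : V → ℤ` of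
`∑_{(u,v) ∈ E} w e * max (r u - r v + s e) 0` (with `∞ · 0 = 0`) equals the supremum,
over circulations `f` (nonnegative, respecting finite capacities, conserving flow at
every vertex), of `∑_{e ∈ E} s e * f e`, both viewed as values in `[0, ∞]`. -/
theorem agony_with_shifts_eq_capacitated_circulation
    {V : Type*} [Fintype V] [DecidableEq V]
    (E : Finset (V × V)) (w : V × V → ℝ≥0∞) (s : V × V → ℤ) :
    (⨅ r : V → ℤ,
        ∑ e ∈ E, w e * (((max (r e.1 - r e.2 + s e) 0).toNat : ℕ) : ℝ≥0∞))
      =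
    ⨆ f : {f : V × V → ℝ //
        (∀ e ∈ E, 0 ≤ f e) ∧
        (∀ e ∈ E, w e ≠ ⊤ → ENNReal.ofReal (f e) ≤ w e) ∧
        (∀ v : V, (∑ e ∈ E.filter (fun e => e.2 = v), f e)
            = ∑ e ∈ E.filter (fun e => e.1 = v), f e)},
      ENNReal.ofReal (∑ e ∈ E, (s e : ℝ) * f.1 e) := by
  simp only [natCast_toNat_max_zero]
  apply le_antisymm
  · set C := ⨆ f : {f : V × V → ℝ //
        (∀ e ∈ E, 0 ≤ f e) ∧
        (∀ e ∈ E, w e ≠ ⊤ → ENNReal.ofReal (f e) ≤ w e) ∧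
        (∀ v : V, (∑ e ∈ E.filter (fun e => e.2 = v), f e)
            = ∑ e ∈ E.filter (fun e => e.1 = v), f e)},
      ENNReal.ofReal (∑ e ∈ E, (s e : ℝ) * f.1 e) with hC
    by_cases htop : C = ⊤
    · rw [htop]
      exact le_top
    set M : ℝ := C.toReal + 1 with hM
    have hM0 : 0 < M := by positivity
    obtain ⟨f, hf, hcirc, r, hr⟩ := exists_circulation_rank_eq E
      (fun e => if w e = ⊤ then M else (w e).toReal)
      (fun e => by dsimp only [Pi.zero_apply]; split_ifs <;> positivity) s
    have hfC : ENNReal.ofReal (∑ e ∈ E, (s e : ℝ) * f e) ≤ C := by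
      refine le_iSup_of_le ⟨f, fun e _ => hf.1 e, fun e _ hw => ?_,
        (conservation_iff_forall_potential E f).2 hcirc⟩ le_rfl
      have := hf.2 e
      simp only [if_neg hw] at this
      exact ENNReal.ofReal_le_of_le_toReal this
    have hlt : ∑ e ∈ E, (s e : ℝ) * f e < M := by
      have := (ENNReal.ofReal_le_iff_le_toReal htop).1 hfC
      linarith
    have hnonneg : ∀ e ∈ E, 0 ≤ (if w e = ⊤ then M else (w e).toReal) *
        ((max (r e.1 - r e.2 + s e) 0 : ℤ) : ℝ) := by
      intro e _
      have : (0 : ℝ) ≤ ((max (r e.1 - r e.2 + s e) 0 : ℤ) : ℝ) := by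
        exact_mod_cast le_max_right _ _
      refine mul_nonneg ?_ this
      split_ifs <;> positivity
    refine (iInf_le _ r).trans (le_trans (le_of_eq ?_) hfC)
    rw [← hr, ENNReal.ofReal_sum_of_nonneg hnonneg]
    refine Finset.sum_congr rfl fun e he => ?_
    split_ifs with hw
    · have hle := Finset.single_le_sum hnonneg he
      rw [hr, if_pos hw] at hle
      have hlt1 : ((max (r e.1 - r e.2 + s e) 0 : ℤ) : ℝ) < 1 := by
        by_contra! h
        nlinarith
      have hlt1' : max (r e.1 - r e.2 + s e) 0 < 1 := by exact_mod_cast hlt1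
      have hzero : max (r e.1 - r e.2 + s e) 0 = 0 :=
        le_antisymm (Int.lt_add_one_iff.1 hlt1') (le_max_right _ _)
      rw [hzero]
      simp
    · rw [ENNReal.ofReal_mul ENNReal.toReal_nonneg, ENNReal.ofReal_toReal hw]
  · refine iSup_le fun ⟨f, hf0, hfw, hcons⟩ => le_iInf fun r => ?_
    have hcirc := (conservation_iff_forall_potential E f).1 hcons fun v => (r v : ℝ)
    have hle : ∑ e ∈ E, (s e : ℝ) * f e ≤
        ∑ e ∈ E, f e * ((max (r e.1 - r e.2 + s e) 0 : ℤ) : ℝ) := by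
      rw [← sub_zero (∑ e ∈ E, (s e : ℝ) * f e), ← hcirc, ← Finset.sum_sub_distrib]
      refine Finset.sum_le_sum fun e he => ?_
      calc (s e : ℝ) * f e - f e * ((r e.2 : ℝ) - r e.1)
          = f e * ((r e.1 - r e.2 + s e : ℤ) : ℝ) := by push_cast; ring
        _ ≤ _ := mul_le_mul_of_nonneg_left (Int.cast_le.2 (le_max_left _ _)) (hf0 e he)
    refine (ENNReal.ofReal_le_ofReal hle).trans ?_
    rw [ENNReal.ofReal_sum_of_nonneg fun e he =>
      mul_nonneg (hf0 e he) (Int.cast_nonneg (le_max_right _ _))]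
    refine Finset.sum_le_sum fun e he => ?_
    rw [ENNReal.ofReal_mul (hf0 e he)]
    refine mul_le_mul_left ?_ _
    by_cases hw : w e = ⊤
    · rw [hw]
      exact le_top
    · exact hfw e he hw
end

section
/- Let G = (V, E, w) be a finite weighted directed graph with w : E → ℝ>0 and let k ≥ 1 be an integer. Construct the graph H with vertex set V ∪ {α, ω} (α, ω two new vertices) and the following shifted, capacitated edges: for each e = (u, v) ∈ E an edge (u, v) with shift 1 and capacity w(e); for each v ∈ V, edges (α, v) and (v, ω) with shift 0 and capacity ∞; and an edge (ω, α) with shift 1 − k and capacity ∞. Then the infimum over rank assignments r on the vertices of H of Σ_{edges f=(x,y) of H} capacity(f)·max(r(x) − r(y) + shift(f), 0) (with convention ∞·0 = 0) equals q(G, k, p_lin), the minimum of Σ_{(u,v)∈E} w(u,v)·p_lin(r(u) − r(v)) over rank assignments r : V → {0, …, k−1}. -/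
open scoped ENNReal

theorem top_mul_toNat_max_eq_zero {d : ℤ} (hd : d ≤ 0) :
    (⊤ : ℝ≥0∞) * (((max d 0).toNat : ℕ) : ℝ≥0∞) = 0 := by
  simp [max_eq_right hd]

theorem nonpos_of_top_mul_toNat_max_ne_top {d : ℤ}
    (h : (⊤ : ℝ≥0∞) * (((max d 0).toNat : ℕ) : ℝ≥0∞) ≠ ⊤) : d ≤ 0 := by
  by_contra! hd
  refine h (ENNReal.top_mul ?_)
  simp only [ne_eq, Nat.cast_eq_zero]
  omega

theorem ofReal_sum_mul_max_cast {ι : Type*} (s : Finset ι) (w : ι → ℝ)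
    (hw : ∀ i ∈ s, 0 ≤ w i) (d : ι → ℤ) :
    ENNReal.ofReal (∑ i ∈ s, w i * max (0 : ℝ) ((d i : ℤ) : ℝ)) =
      ∑ i ∈ s, ENNReal.ofReal (w i) * (((max (d i) 0).toNat : ℕ) : ℝ≥0∞) := by
  rw [ENNReal.ofReal_sum_of_nonneg fun i hi => mul_nonneg (hw i hi) (le_max_left _ _)]
  refine Finset.sum_congr rfl fun i hi => ?_
  rw [ENNReal.ofReal_mul (hw i hi), ← ENNReal.ofReal_natCast]
  congr 2
  have h : (((max (d i) 0).toNat : ℕ) : ℤ) = max (d i) 0 := Int.toNat_of_nonneg (le_max_right _ _)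
  rw [← Int.cast_natCast, h, Int.cast_max, Int.cast_zero, max_comm]

theorem exists_min_image_bounded {V : Type*} [Finite V] (a b : ℤ) (hab : a ≤ b)
    (F : (V → ℤ) → ℝ) :
    ∃ r : V → ℤ, (∀ v, a ≤ r v ∧ r v ≤ b) ∧
      ∀ s : V → ℤ, (∀ v, a ≤ s v ∧ s v ≤ b) → F r ≤ F s := by
  have hfin : {r : V → ℤ | ∀ v, a ≤ r v ∧ r v ≤ b}.Finite :=
    Set.Finite.pi' fun _ => Set.finite_Icc a b
  exact Set.exists_min_image _ F hfin ⟨fun _ => a, fun _ => ⟨le_rfl, hab⟩⟩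

/-- the circulation graph `H = cg(G, k)` of a finite weighted directed
graph `G = (V, E, w)` has vertices `V ⊕ {α, ω}` (here `α = Sum.inr true`,
`ω = Sum.inr false`), an edge `(u, v)` with shift `1` and capacity `w e` for each
`e = (u, v) ∈ E`, edges `(α, v)` and `(v, ω)` with shift `0` and capacity `∞` for
each `v ∈ V`, and an edge `(ω, α)` with shift `1 - k` and capacity `∞`.  The infimum
over all rank assignments on `H` of the shifted, capacitated penalty (with
`∞ · 0 = 0`) equals `q(G, k, p_lin)`, the minimum of
`∑_{(u,v) ∈ E} w (u,v) * max 0 (r u - r v + 1)` over `r : V → {0, …, k-1}`. -/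
theorem circulation_graph_computes_agony
    {V : Type*} [Fintype V]
    (E : Finset (V × V)) (w : V × V → ℝ) (hw : ∀ e ∈ E, 0 < w e)
    (k : ℤ) (hk : 1 ≤ k) :
    ∃ c : ℝ,
      IsLeast {x : ℝ | ∃ r : V → ℤ, (∀ v, 0 ≤ r v ∧ r v ≤ k - 1) ∧
        x = ∑ e ∈ E, w e * max (0 : ℝ) ((r e.1 - r e.2 + 1 : ℤ) : ℝ)} c ∧
      (⨅ r : V ⊕ Bool → ℤ,
        ((∑ e ∈ E, ENNReal.ofReal (w e) *
            (((max (r (Sum.inl e.1) - r (Sum.inl e.2) + 1) 0).toNat : ℕ) : ℝ≥0∞))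
          + (∑ v : V,
              ((⊤ : ℝ≥0∞) *
                  (((max (r (Sum.inr true) - r (Sum.inl v)) 0).toNat : ℕ) : ℝ≥0∞)
                + (⊤ : ℝ≥0∞) *
                  (((max (r (Sum.inl v) - r (Sum.inr false)) 0).toNat : ℕ) : ℝ≥0∞)))
          + (⊤ : ℝ≥0∞) *
              (((max (r (Sum.inr false) - r (Sum.inr true) + (1 - k)) 0).toNat : ℕ) : ℝ≥0∞)))
        = ENNReal.ofReal c := by
  have hw' : ∀ e ∈ E, 0 ≤ w e := fun e he => (hw e he).le
  obtain ⟨r₀, hr₀, hmin⟩ := exists_min_image_bounded (V := V) 0 (k - 1) (by omega)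
    fun r => ∑ e ∈ E, w e * max (0 : ℝ) ((r e.1 - r e.2 + 1 : ℤ) : ℝ)
  refine ⟨_, ⟨⟨r₀, hr₀, rfl⟩, ?_⟩, le_antisymm ?_ (le_iInf fun r => ?_)⟩
  · rintro _ ⟨r, hr, rfl⟩
    exact hmin r hr
  · refine iInf_le_of_le (Sum.elim r₀ fun b => if b then 0 else k - 1) (le_of_eq ?_)
    rw [ofReal_sum_mul_max_cast E w hw' fun e => r₀ e.1 - r₀ e.2 + 1,
      top_mul_toNat_max_eq_zero (by simp), Finset.sum_eq_zero (s := Finset.univ) fun v _ => ?_]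
    · simp only [Sum.elim_inl, add_zero]
    · rw [top_mul_toNat_max_eq_zero (by simpa using (hr₀ v).1),
        top_mul_toNat_max_eq_zero (by simpa using (hr₀ v).2), add_zero]
  · by_contra! hlt
    have hne := hlt.ne_top
    simp only [ne_eq, ENNReal.add_eq_top, ENNReal.sum_eq_top, not_or, not_exists, not_and,
      Finset.mem_univ, forall_const] at hne
    obtain ⟨⟨-, hv⟩, hωα⟩ := hne
    have hωα := nonpos_of_top_mul_toNat_max_ne_top hωα
    refine hlt.not_ge ?_
    rw [add_assoc]
    refine le_add_right ?_
    rw [← ofReal_sum_mul_max_cast E w hw' fun e => r (Sum.inl e.1) - r (Sum.inl e.2) + 1]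
    refine ENNReal.ofReal_le_ofReal ?_
    have hle := hmin (fun v => r (Sum.inl v) - r (Sum.inr true)) fun v => by
      have hα := nonpos_of_top_mul_toNat_max_ne_top (hv v).1
      have hω := nonpos_of_top_mul_toNat_max_ne_top (hv v).2
      omega
    simpa only [sub_sub_sub_cancel_right] using hle
end

section
/- Let G = (V, E, w) be a finite weighted directed graph, let k = |V|, and let C_1, …, C_s be the strongly connected components of G listed in a topological order, i.e., every edge between two distinct components goes from a component with smaller index to one with larger index. For each i, let r_i : C_i → {0, …, |C_i| − 1} be a rank assignment minimizing the agony of the induced subgraph G(C_i) among rank assignments with values in {0, …, |C_i| − 1}, and let b_i = Σ_{j < i} |C_j|. Then the rank assignment r defined by r(v) = r_i(v) + b_i when v ∈ C_i takes values in {0, …, k − 1} and attains q(G, k, p_lin). -/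
/-- The agony of a rank assignment `r` on a weighted directed graph `(V, E, w)`:
`∑_{(u,v) ∈ E} w (u,v) * max 0 (r u - r v + 1)`. -/
def agonyOf {V : Type*} (E : Finset (V × V)) (w : V × V → ℝ) (r : V → ℤ) : ℝ :=
  ∑ e ∈ E, w e * max (0 : ℝ) ((r e.1 - r e.2 + 1 : ℤ) : ℝ)

/-- Any rank assignment can be compressed to take values in `{0, …, |S| - 1}` on a finite set `S`
without increasing the agony of the edges inside `S`. -/
theorem exists_compressed_rank {V : Type*} (S : Finset V) (ρ : V → ℤ) :
    ∃ σ : V → ℤ, (∀ v ∈ S, 0 ≤ σ v ∧ σ v ≤ (S.card : ℤ) - 1) ∧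
      ∀ u ∈ S, ∀ v ∈ S, max (0 : ℝ) ((σ u - σ v + 1 : ℤ) : ℝ) ≤
        max (0 : ℝ) ((ρ u - ρ v + 1 : ℤ) : ℝ) := by
  refine ⟨fun v => (((S.image ρ).filter (fun x => x < ρ v)).card : ℤ), ?_, ?_⟩
  · intro v hv
    refine ⟨by positivity, ?_⟩
    have hlt : ((S.image ρ).filter (fun x => x < ρ v)).card < (S.image ρ).card := by
      apply Finset.card_lt_card
      rw [Finset.filter_ssubset]
      exact ⟨ρ v, Finset.mem_image_of_mem ρ hv, lt_irrefl _⟩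
    have hle : (S.image ρ).card ≤ S.card := Finset.card_image_le
    show (((S.image ρ).filter (fun x => x < ρ v)).card : ℤ) ≤ (S.card : ℤ) - 1
    omega
  · intro u hu v hv
    rcases lt_or_ge (ρ u) (ρ v) with h | h
    · have hlt : ((S.image ρ).filter (fun x => x < ρ u)).card <
          ((S.image ρ).filter (fun x => x < ρ v)).card := by
        apply Finset.card_lt_card
        rw [Finset.ssubset_iff_of_subset]
        · exact ⟨ρ u, by simp only [Finset.mem_filter]; exact ⟨Finset.mem_image_of_mem ρ hu, h⟩,
            by simp⟩
        · exact Finset.monotone_filter_right _ fun x _ hx => lt_trans hx h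
      refine le_trans (max_le le_rfl ?_) (le_max_left _ _)
      have : ((((S.image ρ).filter (fun x => x < ρ u)).card : ℤ) -
          (((S.image ρ).filter (fun x => x < ρ v)).card : ℤ) + 1) ≤ 0 := by omega
      exact Int.cast_nonpos.2 this
    · have hsub : (S.image ρ).filter (fun x => x < ρ u) ⊆
          (S.image ρ).filter (fun x => x < ρ v) ∪ Finset.Ico (ρ v) (ρ u) := by
        intro x hx
        simp only [Finset.mem_filter, Finset.mem_union, Finset.mem_Ico] at hx ⊢
        rcases lt_or_ge x (ρ v) with hxv | hxv
        · exact Or.inl ⟨hx.1, hxv⟩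
        · exact Or.inr ⟨hxv, hx.2⟩
      have hcard := (Finset.card_le_card hsub).trans (Finset.card_union_le _ _)
      rw [Int.card_Ico] at hcard
      refine max_le_max le_rfl ?_
      have : ((((S.image ρ).filter (fun x => x < ρ u)).card : ℤ) -
          (((S.image ρ).filter (fun x => x < ρ v)).card : ℤ) + 1) ≤ ρ u - ρ v + 1 := by omega
      exact Int.cast_le.2 this

/-- let `C 0, …, C (s-1)` be the strongly connected components of a
weighted directed graph, listed in topological order, let `ri i` minimize the agony of
the induced subgraph on `C i` among rank assignments into `{0, …, |C i| - 1}`, and let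
`b i = ∑_{j < i} |C j|`.  Then `r v = ri i v + b i` (for `v ∈ C i`) takes values in
`{0, …, |V| - 1}` and minimizes the agony over all rank assignments with values in
`{0, …, |V| - 1}`. -/
theorem scc_decomposition_optimal
    {V : Type*} [Fintype V] [DecidableEq V]
    (E : Finset (V × V)) (w : V × V → ℝ) (hw : ∀ e ∈ E, 0 < w e)
    (s : ℕ) (C : Fin s → Finset V)
    (hpart : ∀ v : V, ∃! i : Fin s, v ∈ C i)
    (hconn : ∀ i : Fin s, ∀ u ∈ C i, ∀ v ∈ C i,
      Relation.ReflTransGen (fun a b => (a, b) ∈ E) u v)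
    (hmaximal : ∀ u v : V,
      Relation.ReflTransGen (fun a b => (a, b) ∈ E) u v →
      Relation.ReflTransGen (fun a b => (a, b) ∈ E) v u →
      ∀ i : Fin s, u ∈ C i → v ∈ C i)
    (htopo : ∀ i j : Fin s, ∀ u ∈ C i, ∀ v ∈ C j, (u, v) ∈ E → i ≠ j → i < j)
    (ri : Fin s → V → ℤ)
    (hri_range : ∀ i : Fin s, ∀ v ∈ C i, 0 ≤ ri i v ∧ ri i v ≤ ((C i).card : ℤ) - 1)
    (hri_min : ∀ i : Fin s, ∀ ρ : V → ℤ,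
      (∀ v ∈ C i, 0 ≤ ρ v ∧ ρ v ≤ ((C i).card : ℤ) - 1) →
      agonyOf (E.filter (fun e => e.1 ∈ C i ∧ e.2 ∈ C i)) w (ri i) ≤
        agonyOf (E.filter (fun e => e.1 ∈ C i ∧ e.2 ∈ C i)) w ρ)
    (r : V → ℤ)
    (hr : ∀ i : Fin s, ∀ v ∈ C i,
      r v = ri i v + ∑ j ∈ Finset.univ.filter (fun j => j < i), ((C j).card : ℤ)) :
    (∀ v : V, 0 ≤ r v ∧ r v ≤ (Fintype.card V : ℤ) - 1) ∧
    ∀ ρ : V → ℤ, (∀ v : V, 0 ≤ ρ v ∧ ρ v ≤ (Fintype.card V : ℤ) - 1) →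
      agonyOf E w r ≤ agonyOf E w ρ := by
  choose c hc hcu using hpart
  have hmem : ∀ (v : V) (i : Fin s), v ∈ C i ↔ c v = i :=
    fun v i => ⟨fun h => (hcu v i h).symm, fun h => h ▸ hc v⟩
  have hcard : ∑ j, ((C j).card : ℤ) = (Fintype.card V : ℤ) := by
    have h := Finset.card_eq_sum_card_fiberwise (f := c) (s := Finset.univ) (t := Finset.univ)
      (fun _ _ => Finset.mem_coe.2 (Finset.mem_univ _))
    rw [← Finset.card_univ, h, Nat.cast_sum]
    refine Finset.sum_congr rfl fun j _ => ?_
    congr 2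
    ext v
    simp [hmem]
  have hoffset : ∀ (i : Fin s) (T : Finset (Fin s)), (∀ j, j ≤ i → j ∈ T) →
      ∑ j ∈ Finset.univ.filter (fun j => j < i), ((C j).card : ℤ) + ((C i).card : ℤ) ≤
        ∑ j ∈ T, ((C j).card : ℤ) := by
    intro i T hT
    rw [add_comm, ← Finset.sum_insert (f := fun j => ((C j).card : ℤ))
      (by simp : i ∉ Finset.univ.filter (fun j => j < i))]
    refine Finset.sum_le_sum_of_subset_of_nonneg ?_ fun _ _ _ => Int.natCast_nonneg _
    intro j hj
    simp only [Finset.mem_insert, Finset.mem_filter, Finset.mem_univ, true_and] at hj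
    exact hT j (hj.elim le_of_eq le_of_lt)
  refine ⟨fun v => ?_, fun ρ _ => ?_⟩
  · have h1 := hr (c v) v (hc v)
    have h2 := hri_range (c v) v (hc v)
    have h3 := hoffset (c v) Finset.univ fun j _ => Finset.mem_univ j
    have h4 : 0 ≤ ∑ j ∈ Finset.univ.filter (fun j => j < c v), ((C j).card : ℤ) :=
      Finset.sum_nonneg fun _ _ => Int.natCast_nonneg _
    constructor <;> linarith
  · unfold agonyOf at *
    rw [← Finset.sum_fiberwise E (fun e => c e.1), ← Finset.sum_fiberwise E (fun e => c e.1)]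
    refine Finset.sum_le_sum fun i _ => ?_
    have hsub : E.filter (fun e => e.1 ∈ C i ∧ e.2 ∈ C i) ⊆ E.filter (fun e => c e.1 = i) :=
      Finset.monotone_filter_right _ fun e _ he => (hmem _ _).1 he.1
    obtain ⟨σ, hσ, hσρ⟩ := exists_compressed_rank (C i) ρ
    calc ∑ e ∈ E.filter (fun e => c e.1 = i), w e * max (0 : ℝ) ((r e.1 - r e.2 + 1 : ℤ) : ℝ)
        = ∑ e ∈ E.filter (fun e => e.1 ∈ C i ∧ e.2 ∈ C i),
            w e * max (0 : ℝ) ((r e.1 - r e.2 + 1 : ℤ) : ℝ) := by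
          symm
          refine Finset.sum_subset hsub fun e he hne => ?_
          simp only [Finset.mem_filter] at he hne
          have h1 : e.1 ∈ C i := (hmem _ _).2 he.2
          have h2 : i ≠ c e.2 := fun h => hne ⟨he.1, h1, (hmem _ _).2 h.symm⟩
          have h3 := htopo i (c e.2) e.1 h1 e.2 (hc _) he.1 h2
          have h4 := hoffset i (Finset.univ.filter (fun j => j < c e.2)) fun j hj => by
            simpa using lt_of_le_of_lt hj h3
          have h5 : r e.1 - r e.2 + 1 ≤ 0 := by
            rw [hr i e.1 h1, hr _ e.2 (hc _)]
            have := hri_range i e.1 h1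
            have := hri_range _ e.2 (hc e.2)
            linarith
          rw [max_eq_left (Int.cast_nonpos.2 h5), mul_zero]
      _ = ∑ e ∈ E.filter (fun e => e.1 ∈ C i ∧ e.2 ∈ C i),
            w e * max (0 : ℝ) ((ri i e.1 - ri i e.2 + 1 : ℤ) : ℝ) := by
          refine Finset.sum_congr rfl fun e he => ?_
          simp only [Finset.mem_filter] at he
          rw [hr i e.1 he.2.1, hr i e.2 he.2.2, add_sub_add_right_eq_sub]
      _ ≤ ∑ e ∈ E.filter (fun e => e.1 ∈ C i ∧ e.2 ∈ C i),
            w e * max (0 : ℝ) ((σ e.1 - σ e.2 + 1 : ℤ) : ℝ) := hri_min i σ hσ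
      _ ≤ ∑ e ∈ E.filter (fun e => e.1 ∈ C i ∧ e.2 ∈ C i),
            w e * max (0 : ℝ) ((ρ e.1 - ρ e.2 + 1 : ℤ) : ℝ) := by
          refine Finset.sum_le_sum fun e he => ?_
          simp only [Finset.mem_filter] at he
          exact mul_le_mul_of_nonneg_left (hσρ _ he.2.1 _ he.2.2) (hw e he.1).le
      _ ≤ ∑ e ∈ E.filter (fun e => c e.1 = i),
            w e * max (0 : ℝ) ((ρ e.1 - ρ e.2 + 1 : ℤ) : ℝ) :=
          Finset.sum_le_sum_of_subset_of_nonneg hsub fun e he _ =>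
            mul_nonneg (hw e (Finset.mem_filter.1 he).1).le (le_max_left _ _)
end

section
/- Let F = (W, A) be a finite directed graph with edge costs t : A → ℝ, let f : A → ℝ≥0 be a flow and π : W → ℝ dual variables satisfying t(e) + π(y) − π(x) ≥ 0 for every edge e = (x, y) ∈ A and (t(e) + π(y) − π(x))·f(e) = 0 for every e = (x, y) ∈ A. Let α ∈ W, let the residual graph R consist of all edges of A plus reversed edges (y, x) with cost −t(e) for each e = (x, y) with f(e) > 0, weighted by reduced costs, and assume every vertex of W is reachable from α in R. Let d(v) be the shortest reduced-cost distance from α to v in R and set π* = π − d. Then for every π' : W → ℝ with π'(α) = π(α) that satisfies t(e) + π'(y) − π'(x) ≥ 0 for every e = (x, y) ∈ A and (t(e) + π'(y) − π'(x))·f(e) = 0 for every e = (x, y) ∈ A, we have π*(v) ≤ π'(v) for all v ∈ W. -/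
/-- `CostedWalk step u v c`: there is a walk from `u` to `v` along the labelled step
relation `step` whose labels sum to `c`. -/
inductive CostedWalk {W : Type*} (step : W → W → ℝ → Prop) : W → W → ℝ → Prop
  | refl (v : W) : CostedWalk step v v 0
  | cons {u v x : W} {c c' : ℝ} :
      step u v c → CostedWalk step v x c' → CostedWalk step u x (c + c')

/-- If the increments of a potential `p` are bounded by the labels of the steps, then the increment
of `p` along a walk is bounded by the cost of the walk. -/
theorem CostedWalk.sub_le_cost {W : Type*} {step : W → W → ℝ → Prop} {p : W → ℝ}
    (hp : ∀ x y c, step x y c → p y - p x ≤ c) {u v : W} {c : ℝ}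
    (h : CostedWalk step u v c) : p v - p u ≤ c := by
  induction h with
  | refl v => simp
  | cons hstep _ ih => linarith [hp _ _ _ hstep]

/-- given a flow `f` and duals `π` with nonnegative reduced costs and
complementary slackness, a vertex `α`, the residual edge relation `Redge`, and `d v`
the shortest reduced-cost residual distance from `α` to `v`, the updated duals
`π* = π - d` are pointwise `≤ π'` for every dual solution `π'` with `π' α = π α`
that has nonnegative reduced costs and satisfies complementary slackness with `f`. -/
theorem canonical_dual_is_pointwise_minimal
    {W : Type*} [Fintype W]
    (A : Finset (W × W)) (t : W × W → ℝ) (f : W × W → ℝ) (π : W → ℝ)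
    (hf : ∀ e ∈ A, 0 ≤ f e)
    (hdual : ∀ e ∈ A, 0 ≤ t e + π e.2 - π e.1)
    (hslack : ∀ e ∈ A, (t e + π e.2 - π e.1) * f e = 0)
    (Redge : W → W → ℝ → Prop)
    (hRedge : ∀ u v τ, Redge u v τ ↔
      (((u, v) ∈ A ∧ τ = t (u, v)) ∨
        ((v, u) ∈ A ∧ 0 < f (v, u) ∧ τ = -t (v, u))))
    (α : W) (d : W → ℝ)
    (hd : ∀ v : W, IsLeast
      {c : ℝ | CostedWalk (fun x y c => ∃ τ, Redge x y τ ∧ c = τ + π y - π x) α v c}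
      (d v)) :
    ∀ π' : W → ℝ, π' α = π α →
      (∀ e ∈ A, 0 ≤ t e + π' e.2 - π' e.1) →
      (∀ e ∈ A, (t e + π' e.2 - π' e.1) * f e = 0) →
      ∀ v : W, π v - d v ≤ π' v := by
  intro π' hα hdual' hslack' v
  have hwalk := CostedWalk.sub_le_cost (p := fun x => π x - π' x) ?_ (hd v).1
  · linarith
  · rintro x y c ⟨τ, hR, rfl⟩
    rcases (hRedge x y τ).1 hR with ⟨hA, rfl⟩ | ⟨hA, hpos, rfl⟩
    · linarith [hdual' _ hA]
    · have htight := (mul_eq_zero.1 (hslack' _ hA)).resolve_right hpos.ne'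
      dsimp only at htight
      linarith
end

section
/- Let G = (V, E, w) be a finite weighted directed graph and k ≥ 1 an integer. Among all rank assignments r : V → {0, …, k − 1} attaining the minimum agony q(G, k, p_lin), there exists a unique rank assignment r such that r(v) ≤ r'(v) for every vertex v ∈ V and every minimizer r'. -/
/-- The linear penalty is submodular along each edge. -/
theorem linear_penalty_submodular (a b c d : ℤ) :
    max 0 (a ⊓ c - b ⊓ d + 1) + max 0 (a ⊔ c - b ⊔ d + 1) ≤
      max 0 (a - b + 1) + max 0 (c - d + 1) := by
  omega

/-- Agony is a submodular function of the rank assignment. -/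
theorem agonyOf_inf_add_agonyOf_sup_le {V : Type*} {E : Finset (V × V)} {w : V × V → ℝ}
    (hw : ∀ e ∈ E, 0 ≤ w e) (r s : V → ℤ) :
    agonyOf E w (r ⊓ s) + agonyOf E w (r ⊔ s) ≤ agonyOf E w r + agonyOf E w s := by
  unfold agonyOf
  rw [← Finset.sum_add_distrib, ← Finset.sum_add_distrib]
  refine Finset.sum_le_sum fun e he => ?_
  rw [← mul_add, ← mul_add]
  refine mul_le_mul_of_nonneg_left ?_ (hw e he)
  exact_mod_cast linear_penalty_submodular (r e.1) (r e.2) (s e.1) (s e.2)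

/-- The minimizers of a submodular function on a sublattice are closed under infima. -/
theorem infClosed_setOf_isMinOn {α : Type*} [Lattice α] {S : Set α} (hinf : InfClosed S)
    (hsup : SupClosed S) {f : α → ℝ}
    (hf : ∀ a b, f (a ⊓ b) + f (a ⊔ b) ≤ f a + f b) :
    InfClosed {a | a ∈ S ∧ IsMinOn f S a} := by
  rintro a ⟨ha, hamin⟩ b ⟨hb, hbmin⟩
  refine ⟨hinf ha hb, isMinOn_iff.2 fun c hc => ?_⟩
  have hsup_le := isMinOn_iff.1 hbmin _ (hsup ha hb)
  have hac := isMinOn_iff.1 hamin c hc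
  linarith [hf a b]

/-- A finite nonempty set closed under infima has a least element. -/
theorem InfClosed.exists_isLeast {α : Type*} [SemilatticeInf α] {S : Set α} (hS : InfClosed S)
    (hfin : S.Finite) (hne : S.Nonempty) : ∃ a, IsLeast S a := by
  have hne' : hfin.toFinset.Nonempty := hfin.toFinset_nonempty.2 hne
  exact ⟨hfin.toFinset.inf' hne' id,
    hS.finsetInf'_mem hne' fun a ha => hfin.mem_toFinset.1 ha,
    fun a ha => Finset.inf'_le id (hfin.mem_toFinset.2 ha)⟩

/-- among the rank assignments `r : V → {0, …, k-1}` minimizing agony,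
there is a unique one that is pointwise `≤` every minimizer. -/
theorem canonical_minimizer_exists_unique
    {V : Type*} [Fintype V]
    (E : Finset (V × V)) (w : V × V → ℝ) (hw : ∀ e ∈ E, 0 < w e)
    (k : ℤ) (hk : 1 ≤ k) :
    ∃! r : V → ℤ,
      ((∀ v, 0 ≤ r v ∧ r v ≤ k - 1) ∧
        (∀ r' : V → ℤ, (∀ v, 0 ≤ r' v ∧ r' v ≤ k - 1) →
          agonyOf E w r ≤ agonyOf E w r')) ∧
      (∀ r' : V → ℤ,
        ((∀ v, 0 ≤ r' v ∧ r' v ≤ k - 1) ∧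
          (∀ r'' : V → ℤ, (∀ v, 0 ≤ r'' v ∧ r'' v ≤ k - 1) →
            agonyOf E w r' ≤ agonyOf E w r'')) →
        ∀ v, r v ≤ r' v) := by
  classical
  have hIcc (r : V → ℤ) :
      r ∈ Set.Icc (fun _ => 0) (fun _ => k - 1) ↔ ∀ v, 0 ≤ r v ∧ r v ≤ k - 1 :=
    forall_and.symm
  set S : Set (V → ℤ) := Set.Icc (fun _ => 0) (fun _ => k - 1)
  have hfin : S.Finite := Set.finite_Icc _ _
  have hne : S.Nonempty := Set.nonempty_Icc.2 fun _ => by lia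
  have hinf : InfClosed S := fun a ha b hb => ⟨le_inf ha.1 hb.1, inf_le_left.trans ha.2⟩
  have hsup : SupClosed S := fun a ha b hb => ⟨ha.1.trans le_sup_left, sup_le ha.2 hb.2⟩
  obtain ⟨m, hm⟩ := Set.exists_min_image S (agonyOf E w) hfin hne
  obtain ⟨r, hr⟩ := (infClosed_setOf_isMinOn hinf hsup
    (agonyOf_inf_add_agonyOf_sup_le fun e he => (hw e he).le)).exists_isLeast
      (hfin.subset fun _ h => h.1) ⟨m, hm.1, isMinOn_iff.2 hm.2⟩
  simp only [← hIcc]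
  exact ⟨r, ⟨⟨hr.1.1, fun s hs => isMinOn_iff.1 hr.1.2 s hs⟩,
    fun s hs => hr.2 ⟨hs.1, isMinOn_iff.2 hs.2⟩⟩,
    fun s hs => le_antisymm (fun v => hs.2 r ⟨hr.1.1, isMinOn_iff.1 hr.1.2⟩ v)
      (hr.2 ⟨hs.1.1, isMinOn_iff.2 hs.1.2⟩)⟩
end

section
/- Let G = (V, E, w) be a finite weighted directed graph, k ≥ 1 an integer, and let r be the canonical ranking, i.e., the rank assignment r : V → {0, …, k − 1} attaining q(G, k, p_lin) that satisfies r(v) ≤ r'(v) for every v ∈ V and every minimizer r'. Then the number of distinct values taken by r is at most the number of distinct values taken by any rank assignment r' : V → {0, …, k − 1} attaining q(G, k, p_lin). -/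
/-- The number of elements of `S` strictly below `x`. -/
def levelIndex (S : Finset ℤ) (x : ℤ) : ℤ := ((S.filter (· < x)).card : ℤ)

lemma levelIndex_nonneg (S : Finset ℤ) (x : ℤ) : 0 ≤ levelIndex S x :=
  Int.natCast_nonneg _

lemma levelIndex_lt_card {S : Finset ℤ} {x : ℤ} (hx : x ∈ S) : levelIndex S x < S.card := by
  refine Int.ofNat_lt.mpr (Finset.card_lt_card ?_)
  exact Finset.filter_ssubset.mpr ⟨x, hx, lt_irrefl x⟩

lemma levelIndex_lt_levelIndex {S : Finset ℤ} {x y : ℤ} (hx : x ∈ S) (hxy : x < y) :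
    levelIndex S x < levelIndex S y := by
  refine Int.ofNat_lt.mpr (Finset.card_lt_card ?_)
  refine Finset.ssubset_iff_of_subset (fun a ha => ?_) |>.mpr ⟨x, by simp [hx, hxy], by simp⟩
  simp only [Finset.mem_filter] at ha ⊢
  exact ⟨ha.1, ha.2.trans hxy⟩

lemma levelIndex_sub_le (S : Finset ℤ) {x y : ℤ} (hxy : x ≤ y) :
    levelIndex S y - levelIndex S x ≤ y - x := by
  have hsub : S.filter (· < y) ⊆ S.filter (· < x) ∪ Finset.Ico x y := by
    intro a ha
    simp only [Finset.mem_filter, Finset.mem_union, Finset.mem_Ico] at ha ⊢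
    rcases lt_or_ge a x with h | h
    · exact Or.inl ⟨ha.1, h⟩
    · exact Or.inr ⟨h, ha.2⟩
  have h := (Finset.card_le_card hsub).trans (Finset.card_union_le _ _)
  rw [Int.card_Ico] at h
  unfold levelIndex
  omega

/-- Closing the gaps between the used levels of a rank assignment does not increase agony. -/
lemma agonyOf_levelIndex_le {V : Type*} (E : Finset (V × V)) (w : V × V → ℝ)
    (hw : ∀ e ∈ E, 0 ≤ w e) (S : Finset ℤ) (r : V → ℤ) (hr : ∀ v, r v ∈ S) :
    agonyOf E w (fun v => levelIndex S (r v)) ≤ agonyOf E w r := by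
  refine Finset.sum_le_sum fun e he => mul_le_mul_of_nonneg_left ?_ (hw e he)
  rcases lt_or_ge (r e.1) (r e.2) with h | h
  · refine max_le (le_max_left _ _) (le_max_of_le_left ?_)
    have := levelIndex_lt_levelIndex (hr e.1) h
    exact_mod_cast (by omega : levelIndex S (r e.1) - levelIndex S (r e.2) + 1 ≤ 0)
  · refine max_le_max le_rfl (Int.cast_le.mpr ?_)
    have := levelIndex_sub_le S h
    dsimp only
    omega

/-- the canonical ranking (the agony minimizer over ranks into
`{0, …, k-1}` that is pointwise `≤` every minimizer) takes at most as many distinct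
values as any other minimizer. -/
theorem canonical_minimizer_fewest_levels
    {V : Type*} [Fintype V]
    (E : Finset (V × V)) (w : V × V → ℝ) (hw : ∀ e ∈ E, 0 < w e)
    (k : ℤ) (hk : 1 ≤ k)
    (r : V → ℤ)
    (hr_range : ∀ v, 0 ≤ r v ∧ r v ≤ k - 1)
    (hr_min : ∀ r' : V → ℤ, (∀ v, 0 ≤ r' v ∧ r' v ≤ k - 1) →
      agonyOf E w r ≤ agonyOf E w r')
    (hr_canon : ∀ r' : V → ℤ,
      (∀ v, 0 ≤ r' v ∧ r' v ≤ k - 1) →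
      (∀ r'' : V → ℤ, (∀ v, 0 ≤ r'' v ∧ r'' v ≤ k - 1) →
        agonyOf E w r' ≤ agonyOf E w r'') →
      ∀ v, r v ≤ r' v) :
    ∀ r' : V → ℤ,
      (∀ v, 0 ≤ r' v ∧ r' v ≤ k - 1) →
      (∀ r'' : V → ℤ, (∀ v, 0 ≤ r'' v ∧ r'' v ≤ k - 1) →
        agonyOf E w r' ≤ agonyOf E w r'') →
      (Finset.univ.image r).card ≤ (Finset.univ.image r').card := by
  intro r' hr' hmin
  set S := Finset.univ.image r' with hS
  have hmem : ∀ v, r' v ∈ S := fun v => Finset.mem_image_of_mem r' (Finset.mem_univ v)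
  have hcard : (S.card : ℤ) ≤ k := by
    have hsub : S ⊆ Finset.Ico 0 k := by
      intro a ha
      obtain ⟨v, -, rfl⟩ := Finset.mem_image.mp ha
      have := hr' v
      exact Finset.mem_Ico.mpr (by omega)
    have h := Finset.card_le_card hsub
    rw [Int.card_Ico] at h
    omega
  have hle := hr_canon (fun v => levelIndex S (r' v))
    (fun v => ⟨levelIndex_nonneg S _, by have := levelIndex_lt_card (hmem v); omega⟩)
    (fun r'' h'' => (agonyOf_levelIndex_le E w (fun e he => (hw e he).le) S r' hmem).trans
      (hmin r'' h''))
  have hsub : Finset.univ.image r ⊆ Finset.Ico 0 (S.card : ℤ) := by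
    intro a ha
    obtain ⟨v, -, rfl⟩ := Finset.mem_image.mp ha
    exact Finset.mem_Ico.mpr ⟨(hr_range v).1, (hle v).trans_lt (levelIndex_lt_card (hmem v))⟩
  simpa using Finset.card_le_card hsub
end

section
/- Let G = (V, E, w) be a finite weighted directed acyclic graph, and define r(v) to be the maximum number of edges on a directed path in G ending at v. Then the agony of r is zero, i.e., q(G, r, p_lin) = 0, and for every rank assignment r' : V → ℕ with q(G, r', p_lin) = 0 we have r(v) ≤ r'(v) for all v ∈ V. -/
theorem agonyOf_eq_zero_iff {V : Type*} {E : Finset (V × V)} {w : V × V → ℝ}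
    (hw : ∀ e ∈ E, 0 < w e) (r : V → ℤ) :
    agonyOf E w r = 0 ↔ ∀ e ∈ E, r e.1 < r e.2 := by
  unfold agonyOf
  rw [Finset.sum_eq_zero_iff_of_nonneg
    fun e he => mul_nonneg (hw e he).le (le_max_left _ _)]
  refine forall₂_congr fun e he => ?_
  rw [mul_eq_zero, or_iff_right (hw e he).ne', max_eq_left_iff, Int.cast_nonpos]
  omega

theorem List.IsChain.length_le_of_lt {V : Type*} {R : V → V → Prop} {f : V → ℕ}
    (hf : ∀ a b, R a b → f a < f b) {l : List V} (hl : l.IsChain R) {v : V}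
    (hv : l.getLast? = some v) : l.length ≤ f v + 1 := by
  induction l using List.reverseRecOn generalizing v with
  | nil => simp at hv
  | append_singleton l a ih =>
    obtain rfl : a = v := by simpa using hv
    rw [List.isChain_append] at hl
    rcases hlast : l.getLast? with _ | u
    · simp [List.getLast?_eq_none_iff.mp hlast]
    · have hu := ih hl.1 hlast
      have huv := hf u a (hl.2.2 u (by simp [hlast]) a (by simp))
      simp only [List.length_append, List.length_singleton]
      omega

/-- on a finite weighted DAG, the ranking `r v` = maximum number of
edges on a directed path ending at `v` has zero agony, and it is pointwise minimal
among all ℕ-valued rankings of zero agony. -/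
theorem dag_longest_path_rank_canonical
    {V : Type*} [Fintype V]
    (E : Finset (V × V)) (w : V × V → ℝ) (hw : ∀ e ∈ E, 0 < w e)
    (hacyclic : ∀ v : V, ¬ Relation.TransGen (fun a b => (a, b) ∈ E) v v)
    (r : V → ℕ)
    (hr : ∀ v : V, IsGreatest
      {n : ℕ | ∃ l : List V, l.Chain' (fun a b => (a, b) ∈ E) ∧
        l.getLast? = some v ∧ l.length = n + 1} (r v)) :
    agonyOf E w (fun v => (r v : ℤ)) = 0 ∧
    ∀ r' : V → ℕ, agonyOf E w (fun v => (r' v : ℤ)) = 0 → ∀ v : V, r v ≤ r' v := by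
  constructor
  · rw [agonyOf_eq_zero_iff hw]
    rintro ⟨u, v⟩ he
    obtain ⟨l, hl, hlast, hlen⟩ := (hr u).1
    have hle : r u + 1 ≤ r v := by
      refine (hr v).2 ⟨l ++ [v], List.isChain_append.mpr ⟨hl, by simp, ?_⟩, by simp, by simp [hlen]⟩
      intro x hx y hy
      obtain rfl : u = x := by simpa [hlast] using hx
      obtain rfl : v = y := by simpa using hy
      exact he
    simp only
    omega
  · intro r' hr' v
    rw [agonyOf_eq_zero_iff hw] at hr'
    obtain ⟨l, hl, hlast, hlen⟩ := (hr v).1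
    have hle := List.IsChain.length_le_of_lt (f := r')
      (fun a b hab => by exact_mod_cast hr' (a, b) hab) hl hlast
    omega
end

section
/- Let G = (V, E, w) be a finite weighted directed graph, let r : V → ℤ be a rank assignment, and let ρ ∈ ℤ. Write X = {v : r(v) < ρ}, Y = {v : r(v) = ρ}, Z = {v : r(v) > ρ}. Let Y = Y₁ ∪ Y₂ be a partition of Y and define a new rank assignment r' by r'(v) = r(v) for v ∈ X ∪ Y₁, r'(v) = ρ + 1 for v ∈ Y₂, and r'(v) = r(v) + 1 for v ∈ Z. Define back = Σ_{(z,x)∈E, z∈Z, x∈X} w(z,x); for y ∈ Y, inback(y) = Σ_{(z,y)∈E, z∈Z} w(z,y), outback(y) = Σ_{(y,x)∈E, x∈X} w(y,x), flux(y) = Σ_{(x,y)∈E, x∈Y} w(x,y) − Σ_{(y,x)∈E, x∈Y} w(y,x), and diff(y) = flux(y) + inback(y) − outback(y); also inback_total = Σ_{y∈Y} inback(y) and outback_total = Σ_{y∈Y} outback(y). Then q(G, r', p_lin) − q(G, r, p_lin) = back + inback_total − Σ_{y∈Y₂} diff(y), and equivalently q(G, r', p_lin) − q(G, r, p_lin)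 = back + outback_total + Σ_{y∈Y₁} diff(y). -/
/-- Total weight of edges from `Z = {r > ρ}` to `X = {r < ρ}`. -/
def backW {V : Type*} (E : Finset (V × V)) (w : V × V → ℝ) (r : V → ℤ) (ρ : ℤ) : ℝ :=
  ∑ e ∈ E.filter (fun e => ρ < r e.1 ∧ r e.2 < ρ), w e

/-- Total weight of edges from `Z = {r > ρ}` into the vertex `y`. -/
def inbackW {V : Type*} [DecidableEq V] (E : Finset (V × V)) (w : V × V → ℝ)
    (r : V → ℤ) (ρ : ℤ) (y : V) : ℝ :=
  ∑ e ∈ E.filter (fun e => e.2 = y ∧ ρ < r e.1), w e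

/-- Total weight of edges from the vertex `y` to `X = {r < ρ}`. -/
def outbackW {V : Type*} [DecidableEq V] (E : Finset (V × V)) (w : V × V → ℝ)
    (r : V → ℤ) (ρ : ℤ) (y : V) : ℝ :=
  ∑ e ∈ E.filter (fun e => e.1 = y ∧ r e.2 < ρ), w e

/-- Weight of incoming edges from `Y = {r = ρ}` minus weight of outgoing edges to
`Y = {r = ρ}` at the vertex `y`. -/
def fluxW {V : Type*} [DecidableEq V] (E : Finset (V × V)) (w : V × V → ℝ)
    (r : V → ℤ) (ρ : ℤ) (y : V) : ℝ :=
  (∑ e ∈ E.filter (fun e => e.2 = y ∧ r e.1 = ρ), w e)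
    - ∑ e ∈ E.filter (fun e => e.1 = y ∧ r e.2 = ρ), w e

/-- `diff y = flux y + inback y - outback y`. -/
def diffW {V : Type*} [DecidableEq V] (E : Finset (V × V)) (w : V × V → ℝ)
    (r : V → ℤ) (ρ : ℤ) (y : V) : ℝ :=
  fluxW E w r ρ y + inbackW E w r ρ y - outbackW E w r ρ y

theorem sum_sum_filter_eq_and {ι V : Type*} [DecidableEq V] (E : Finset ι) (w : ι → ℝ)
    (f : ι → V) (P : ι → Prop) [DecidablePred P] (S : Finset V) :
    ∑ y ∈ S, ∑ e ∈ E.filter (fun e => f e = y ∧ P e), w e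
      = ∑ e ∈ E, w e * (((if f e ∈ S ∧ P e then 1 else 0 : ℤ)) : ℝ) := by
  simp_rw [Finset.sum_filter]
  rw [Finset.sum_comm]
  refine Finset.sum_congr rfl fun e _ => ?_
  by_cases hP : P e <;> simp [hP]

theorem sum_diffW {V : Type*} [DecidableEq V] (E : Finset (V × V)) (w : V × V → ℝ)
    (r : V → ℤ) (ρ : ℤ) (S : Finset V) :
    ∑ y ∈ S, diffW E w r ρ y = ∑ e ∈ E, w e *
      (((if e.2 ∈ S ∧ r e.1 = ρ then 1 else 0) - (if e.1 ∈ S ∧ r e.2 = ρ then 1 else 0)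
        + (if e.2 ∈ S ∧ ρ < r e.1 then 1 else 0)
        - (if e.1 ∈ S ∧ r e.2 < ρ then 1 else 0) : ℤ) : ℝ) := by
  simp only [diffW, fluxW, inbackW, outbackW, Finset.sum_sub_distrib, Finset.sum_add_distrib,
    sum_sum_filter_eq_and, Int.cast_sub, Int.cast_add, mul_sub, mul_add]

theorem backW_eq_sum {V : Type*} (E : Finset (V × V)) (w : V × V → ℝ) (r : V → ℤ) (ρ : ℤ) :
    backW E w r ρ
      = ∑ e ∈ E, w e * ((if ρ < r e.1 ∧ r e.2 < ρ then 1 else 0 : ℤ) : ℝ) := by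
  simp [backW, Finset.sum_filter]

theorem agonyOf_sub {V : Type*} (E : Finset (V × V)) (w : V × V → ℝ) (r r' : V → ℤ) :
    agonyOf E w r' - agonyOf E w r
      = ∑ e ∈ E, w e *
        ((max 0 (r' e.1 - r' e.2 + 1) - max 0 (r e.1 - r e.2 + 1) : ℤ) : ℝ) := by
  simp only [agonyOf, ← Finset.sum_sub_distrib, ← mul_sub]
  push_cast
  rfl

/-- splitting the level `Y = {r = ρ}` into `Y₁` (kept at rank `ρ`) and
`Y₂` (moved to rank `ρ + 1`) while shifting `Z = {r > ρ}` up by one changes the agony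
by `back + inback_total - ∑_{y ∈ Y₂} diff y`, equivalently by
`back + outback_total + ∑_{y ∈ Y₁} diff y`. -/
theorem split_gain_formula
    {V : Type*} [Fintype V] [DecidableEq V]
    (E : Finset (V × V)) (w : V × V → ℝ) (hw : ∀ e ∈ E, 0 < w e)
    (r r' : V → ℤ) (ρ : ℤ) (Y₁ Y₂ : Finset V)
    (hY : Y₁ ∪ Y₂ = Finset.univ.filter (fun v => r v = ρ))
    (hdisj : Disjoint Y₁ Y₂)
    (hX : ∀ v : V, r v < ρ → r' v = r v)
    (hY₁ : ∀ v ∈ Y₁, r' v = r v)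
    (hY₂ : ∀ v ∈ Y₂, r' v = ρ + 1)
    (hZ : ∀ v : V, ρ < r v → r' v = r v + 1) :
    agonyOf E w r' - agonyOf E w r
      = backW E w r ρ
        + (∑ y ∈ Finset.univ.filter (fun v => r v = ρ), inbackW E w r ρ y)
        - ∑ y ∈ Y₂, diffW E w r ρ y ∧
    agonyOf E w r' - agonyOf E w r
      = backW E w r ρ
        + (∑ y ∈ Finset.univ.filter (fun v => r v = ρ), outbackW E w r ρ y)
        + ∑ y ∈ Y₁, diffW E w r ρ y := by
  have hlevel : ∀ v, (r v < ρ ∧ r' v = r v ∧ v ∉ Y₁ ∧ v ∉ Y₂) ∨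
      (r v = ρ ∧ r' v = ρ ∧ v ∈ Y₁ ∧ v ∉ Y₂) ∨
      (r v = ρ ∧ r' v = ρ + 1 ∧ v ∉ Y₁ ∧ v ∈ Y₂) ∨
      (ρ < r v ∧ r' v = r v + 1 ∧ v ∉ Y₁ ∧ v ∉ Y₂) := by
    intro v
    have hmem : v ∈ Y₁ ∨ v ∈ Y₂ ↔ r v = ρ := by
      rw [← Finset.mem_union, hY]
      simp
    have hnot : v ∈ Y₁ → v ∉ Y₂ := fun h => Finset.disjoint_left.mp hdisj h
    have h₁ := hY₁ v
    have h₂ := hY₂ v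
    have hx := hX v
    have hz := hZ v
    grind
  rw [agonyOf_sub, backW_eq_sum, sum_diffW, sum_diffW]
  simp only [inbackW, outbackW, sum_sum_filter_eq_and, ← Finset.sum_add_distrib,
    ← Finset.sum_sub_distrib, ← mul_add, ← mul_sub, ← Int.cast_add, ← Int.cast_sub,
    Finset.mem_filter, Finset.mem_univ, true_and]
  constructor <;> refine Finset.sum_congr rfl fun e _ => ?_ <;> congr 2 <;>
    rcases hlevel e.1 with ⟨h₁, h₁', hm₁, hn₁⟩ | ⟨h₁, h₁', hm₁, hn₁⟩ | ⟨h₁, h₁', hm₁, hn₁⟩ |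
      ⟨h₁, h₁', hm₁, hn₁⟩ <;>
    rcases hlevel e.2 with ⟨h₂, h₂', hm₂, hn₂⟩ | ⟨h₂, h₂', hm₂, hn₂⟩ | ⟨h₂, h₂', hm₂, hn₂⟩ |
      ⟨h₂, h₂', hm₂, hn₂⟩ <;>
    simp only [hm₁, hn₁, hm₂, hn₂, h₁', h₂', true_and, false_and, if_false] <;>
    omega
end

section
/- Let G = (V, E, w) be a finite weighted directed graph, let r : V → ℤ be a rank assignment, and let ρ ∈ ℤ. Write X = {v : r(v) < ρ}, Y = {v : r(v) = ρ}, Z = {v : r(v) > ρ}; define back = Σ_{(z,x)∈E, z∈Z, x∈X} w(z,x) and, for y ∈ Y, inback(y) = Σ_{(z,y)∈E, z∈Z} w(z,y), outback(y) = Σ_{(y,x)∈E, x∈X} w(y,x), flux(y) = Σ_{(x,y)∈E, x∈Y} w(x,y) − Σ_{(y,x)∈E, x∈Y} w(y,x), diff(y) = flux(y) + inback(y) − outback(y), and outback_total = Σ_{y∈Y} outback(y). For a partition Y = Y₁ ∪ Y₂, let r'[Y₁,Y₂] be the rank assignment with r'(v) = r(v) for v ∈ X ∪ Y₁, r'(v)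 = ρ + 1 for v ∈ Y₂, and r'(v) = r(v) + 1 for v ∈ Z. Then the partition with Y₂* = {y ∈ Y : diff(y) ≥ 0} and Y₁* = Y ∖ Y₂* minimizes q(G, r'[Y₁,Y₂], p_lin) over all partitions (Y₁, Y₂) of Y, and the minimum value of q(G, r'[Y₁,Y₂], p_lin) − q(G, r, p_lin) equals back + outback_total + Σ_{y∈Y, diff(y)<0} diff(y). -/
/-- The rank assignment `r'[Y₁, Y₂]` obtained from `r` by keeping `X = {r < ρ}` and
`Y₁ = {r = ρ} \ Y₂` fixed, moving `Y₂` to rank `ρ + 1`, and shifting `Z = {r > ρ}`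
up by one. -/
def splitRank {V : Type*} [DecidableEq V] (r : V → ℤ) (ρ : ℤ) (Y₂ : Finset V) :
    V → ℤ := fun v =>
  if r v < ρ then r v
  else if r v = ρ then (if v ∈ Y₂ then ρ + 1 else r v)
  else r v + 1

/-- Summing the fibrewise weights of `f` over a set `S` of vertices gives the total weight of
the edges that `f` sends into `S`. -/
theorem sum_fiberwise_filter_eq {V α : Type*} [DecidableEq V] (E : Finset α) (w : α → ℝ)
    (f : α → V) (P : α → Prop) [DecidablePred P] (S : Finset V) :
    ∑ y ∈ S, ∑ e ∈ E.filter (fun e => f e = y ∧ P e), w e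
      = ∑ e ∈ E, if f e ∈ S ∧ P e then w e else 0 := by
  simp_rw [Finset.sum_filter]
  rw [Finset.sum_comm]
  refine Finset.sum_congr rfl fun e _ => ?_
  by_cases hP : P e <;> simp [hP]

/-- Splitting a level changes the agony by `back + outback_total + ∑_{y ∈ Y₁} diff y`. -/
theorem agonyOf_splitRank_sub {V : Type*} [Fintype V] [DecidableEq V]
    (E : Finset (V × V)) (w : V × V → ℝ) (r : V → ℤ) (ρ : ℤ) (Y₂ : Finset V) :
    agonyOf E w (splitRank r ρ Y₂) - agonyOf E w r
      = backW E w r ρ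
        + (∑ y ∈ Finset.univ.filter (fun v => r v = ρ), outbackW E w r ρ y)
        + ∑ y ∈ Finset.univ.filter (fun v => r v = ρ) \ Y₂, diffW E w r ρ y := by
  simp only [agonyOf, backW, diffW, fluxW, inbackW, outbackW, Finset.sum_add_distrib,
    Finset.sum_sub_distrib]
  simp only [sum_fiberwise_filter_eq E w Prod.fst, sum_fiberwise_filter_eq E w Prod.snd]
  rw [Finset.sum_filter]
  simp only [← Finset.sum_add_distrib, ← Finset.sum_sub_distrib]
  refine Finset.sum_congr rfl fun ⟨u, v⟩ _ => ?_
  simp only [Finset.mem_sdiff, Finset.mem_filter, Finset.mem_univ, true_and]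
  suffices h : max 0 (splitRank r ρ Y₂ u - splitRank r ρ Y₂ v + 1) - max 0 (r u - r v + 1)
      = (if ρ < r u ∧ r v < ρ then 1 else 0) + (if r u = ρ ∧ r v < ρ then 1 else 0)
        + ((if (r v = ρ ∧ v ∉ Y₂) ∧ r u = ρ then 1 else 0)
          - (if (r u = ρ ∧ u ∉ Y₂) ∧ r v = ρ then 1 else 0)
          + (if (r v = ρ ∧ v ∉ Y₂) ∧ ρ < r u then 1 else 0)
          - (if (r u = ρ ∧ u ∉ Y₂) ∧ r v < ρ then 1 else 0) : ℤ) by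
    have hR := congrArg (fun n : ℤ => w (u, v) * (n : ℝ)) h
    push_cast at hR ⊢
    simpa only [mul_sub, mul_add, mul_ite, mul_one, mul_zero] using hR
  unfold splitRank
  rcases lt_trichotomy (r u) ρ with hu | hu | hu <;>
  rcases lt_trichotomy (r v) ρ with hv | hv | hv <;>
  by_cases hu2 : u ∈ Y₂ <;> by_cases hv2 : v ∈ Y₂ <;>
  grind

/-- among all partitions `(Y₁, Y₂)` of `Y = {r = ρ}`, taking
`Y₂* = {y ∈ Y : diff y ≥ 0}` minimizes the agony of the split ranking, and the
minimal agony change equals `back + outback_total + ∑_{y ∈ Y, diff y < 0} diff y`. -/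
theorem split_gain_optimal_partition
    {V : Type*} [Fintype V] [DecidableEq V]
    (E : Finset (V × V)) (w : V × V → ℝ) (hw : ∀ e ∈ E, 0 < w e)
    (r : V → ℤ) (ρ : ℤ) :
    (∀ Y₂ : Finset V, Y₂ ⊆ Finset.univ.filter (fun v => r v = ρ) →
      agonyOf E w (splitRank r ρ
          ((Finset.univ.filter (fun v => r v = ρ)).filter (fun y => 0 ≤ diffW E w r ρ y)))
        ≤ agonyOf E w (splitRank r ρ Y₂)) ∧
    agonyOf E w (splitRank r ρ
        ((Finset.univ.filter (fun v => r v = ρ)).filter (fun y => 0 ≤ diffW E w r ρ y)))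
      - agonyOf E w r
      = backW E w r ρ
        + (∑ y ∈ Finset.univ.filter (fun v => r v = ρ), outbackW E w r ρ y)
        + ∑ y ∈ (Finset.univ.filter (fun v => r v = ρ)).filter
            (fun y => diffW E w r ρ y < 0), diffW E w r ρ y := by
  have hsplit := agonyOf_splitRank_sub E w r ρ
  have hcompl : Finset.univ.filter (fun v => r v = ρ) \
      (Finset.univ.filter (fun v => r v = ρ)).filter (fun y => 0 ≤ diffW E w r ρ y)
      = (Finset.univ.filter (fun v => r v = ρ)).filter (fun y => diffW E w r ρ y < 0) := by
    ext y
    simp only [Finset.mem_sdiff, Finset.mem_filter, ← not_le]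
    tauto
  have hopt := hsplit
    ((Finset.univ.filter (fun v => r v = ρ)).filter (fun y => 0 ≤ diffW E w r ρ y))
  rw [hcompl] at hopt
  refine ⟨fun Y₂ _ => ?_, hopt⟩
  have hmin : ∑ y ∈ (Finset.univ.filter (fun v => r v = ρ)).filter
        (fun y => diffW E w r ρ y < 0), diffW E w r ρ y
      ≤ ∑ y ∈ Finset.univ.filter (fun v => r v = ρ) \ Y₂, diffW E w r ρ y := by
    rw [Finset.sdiff_eq_filter, Finset.sum_filter (fun y => diffW E w r ρ y < 0),
      Finset.sum_filter (fun y => y ∉ Y₂)]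
    refine Finset.sum_le_sum fun y _ => ?_
    split_ifs <;> linarith
  linarith [hsplit Y₂]
end

section
/- Let p : ℤ → ℝ be nondecreasing and nonnegative with p(x) = 0 for all x < 0, and let t ≥ 0 and ℓ ≥ 0 be integers such that p(s)/(s + 1) ≥ p(ℓ)/(ℓ + 1) for every integer 0 ≤ s ≤ ℓ. Then the minimum of Σ_{i=0}^{t} p(d_i), over all integer sequences d_0, …, d_t with d_i ≤ ℓ for every i and Σ_{i=0}^{t} d_i = ℓ − t, equals p(ℓ). In particular, every such sequence satisfies Σ_{i=0}^{t} p(d_i) ≥ p(ℓ), and equality is attained by taking t of the d_i equal to −1 and one equal to ℓ. -/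
/-- for a nondecreasing, nonnegative penalty `p` vanishing on negative
integers, such that `p s / (s+1) ≥ p ℓ / (ℓ+1)` for all `0 ≤ s ≤ ℓ`, the minimum of
`∑ i, p (d i)` over integer sequences `d : Fin (t+1) → ℤ` with `d i ≤ ℓ` and
`∑ d i = ℓ - t` equals `p ℓ`; equality is attained by taking one `d i` equal to `ℓ`
and the rest equal to `-1`. -/
theorem concave_path_penalty (p : ℤ → ℝ)
    (hmono : Monotone p) (hnonneg : ∀ x : ℤ, 0 ≤ p x)
    (hzero : ∀ x : ℤ, x < 0 → p x = 0)
    (t ℓ : ℕ)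
    (hratio : ∀ s : ℤ, 0 ≤ s → s ≤ (ℓ : ℤ) →
      p (ℓ : ℤ) / ((ℓ : ℝ) + 1) ≤ p s / ((s : ℝ) + 1)) :
    IsLeast {val : ℝ | ∃ d : Fin (t + 1) → ℤ,
        (∀ i, d i ≤ (ℓ : ℤ)) ∧ (∑ i, d i) = (ℓ : ℤ) - (t : ℤ) ∧
        val = ∑ i, p (d i)} (p (ℓ : ℤ)) ∧
    (∑ i : Fin (t + 1), p (if i = 0 then (ℓ : ℤ) else -1)) = p (ℓ : ℤ) := by
  have hpos : (0 : ℝ) < (ℓ : ℝ) + 1 := by positivity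
  have hline : ∀ x : ℤ, x ≤ (ℓ : ℤ) → p ℓ / ((ℓ : ℝ) + 1) * ((x : ℝ) + 1) ≤ p x := by
    intro x hx
    rcases lt_or_ge x 0 with hneg | hx0
    · have hx1 : (x : ℝ) + 1 ≤ 0 := by exact_mod_cast hneg
      rw [hzero x hneg]
      exact mul_nonpos_of_nonneg_of_nonpos (div_nonneg (hnonneg _) hpos.le) hx1
    · have hx1 : (0 : ℝ) < (x : ℝ) + 1 := by exact_mod_cast Int.lt_add_one_of_le hx0
      exact (le_div_iff₀ hx1).mp (hratio x hx0 hx)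
  have heq : ∑ i : Fin (t + 1), p (if i = 0 then (ℓ : ℤ) else -1) = p ℓ := by
    simp [Fin.sum_univ_succ, hzero (-1) (by norm_num)]
  refine ⟨⟨⟨fun i => if i = 0 then (ℓ : ℤ) else -1, fun i => ?_, ?_, heq.symm⟩, ?_⟩, heq⟩
  · dsimp only
    split_ifs <;> omega
  · simp [Fin.sum_univ_succ, sub_eq_add_neg]
  · rintro _ ⟨d, hd, hsum, rfl⟩
    have hsum' : ∑ i, (d i : ℝ) = (ℓ : ℝ) - t := by exact_mod_cast hsum
    calc p ℓ = p ℓ / ((ℓ : ℝ) + 1) * ∑ i, ((d i : ℝ) + 1) := by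
          rw [Finset.sum_add_distrib, hsum']
          simp
          field_simp
          ring
      _ = ∑ i, p ℓ / ((ℓ : ℝ) + 1) * ((d i : ℝ) + 1) := Finset.mul_sum ..
      _ ≤ ∑ i, p (d i) := Finset.sum_le_sum fun i _ => hline (d i) (hd i)
end

section
/- Let p : ℤ → ℝ be convex, i.e., p(x) ≤ (p(x − 1) + p(x + 1))/2 for every integer x, with p(x) = 0 for all x < 0, and let n ≥ 1 be an integer. Then there exist an integer ℓ with ℓ ≤ n, positive reals α_1, …, α_ℓ, and integers β_1, …, β_ℓ with β_i ≥ −1, such that p(x) = Σ_{i=1}^{ℓ} max(0, α_i(x − β_i)) for every integer x ≤ n − 1. -/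
/-- A convex function on `ℤ` vanishing on the negative integers is, on `x ≤ n - 1`, the sum of the
hinges at `j - 1`, `j < n`, weighted by its second differences. -/
theorem eq_sum_hinge_secondDifference (p : ℤ → ℝ)
    (hconv : ∀ x : ℤ, p x ≤ (p (x - 1) + p (x + 1)) / 2)
    (hzero : ∀ x : ℤ, x < 0 → p x = 0) (n : ℕ) :
    ∀ x : ℤ, x ≤ (n : ℤ) - 1 →
      p x = ∑ j ∈ Finset.range n,
        max 0 ((p j - 2 * p (j - 1) + p (j - 2)) * ((x - ((j : ℤ) - 1) : ℤ) : ℝ)) := by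
  have hc : ∀ j : ℤ, 0 ≤ p j - 2 * p (j - 1) + p (j - 2) := fun j => by
    have h := hconv (j - 1)
    rw [sub_sub, sub_add_cancel] at h
    norm_num at h
    linarith
  induction n with
  | zero =>
    intro x hx
    simpa using hzero x (by push_cast at hx; omega)
  | succ n ih =>
    intro x hx
    rw [Finset.sum_range_succ]
    rcases lt_or_eq_of_le (show x ≤ n by push_cast at hx; omega) with hlt | rfl
    · rw [← ih x (by omega), max_eq_left, add_zero]
      exact mul_nonpos_of_nonneg_of_nonpos (hc n) (Int.cast_nonpos.mpr (by omega))
    · have h1 := ih (n - 1) (by omega)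
      have h2 := ih (n - 2) (by omega)
      have key : ∑ j ∈ Finset.range n,
            max 0 ((p j - 2 * p (j - 1) + p (j - 2)) * (((n : ℤ) - ((j : ℤ) - 1) : ℤ) : ℝ))
          = 2 * p (n - 1) - p (n - 2) := by
        rw [h1, h2, Finset.mul_sum, ← Finset.sum_sub_distrib]
        refine Finset.sum_congr rfl fun j hj => ?_
        have hj' : j < n := Finset.mem_range.mp hj
        have hmax : ∀ y : ℤ, (j : ℤ) - 1 ≤ y →
            max 0 ((p j - 2 * p (j - 1) + p (j - 2)) * ((y - ((j : ℤ) - 1) : ℤ) : ℝ)) =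
              (p j - 2 * p (j - 1) + p (j - 2)) * ((y - ((j : ℤ) - 1) : ℤ) : ℝ) := fun y hy =>
          max_eq_right (mul_nonneg (hc j) (Int.cast_nonneg (by omega)))
        rw [hmax _ (by omega), hmax _ (by omega), hmax _ (by omega)]
        push_cast
        ring
      rw [key, sub_sub_cancel, Int.cast_one, mul_one, max_eq_right (hc n)]
      ring

/-- a convex penalty `p : ℤ → ℝ` vanishing on negative integers agrees,
on all integers `x ≤ n - 1`, with a sum of at most `n` hinge functions
`x ↦ max 0 (αᵢ (x - βᵢ))` with `αᵢ > 0` and integer `βᵢ ≥ -1`. -/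
theorem convex_penalty_hinge_representation (p : ℤ → ℝ)
    (hconv : ∀ x : ℤ, p x ≤ (p (x - 1) + p (x + 1)) / 2)
    (hzero : ∀ x : ℤ, x < 0 → p x = 0)
    (n : ℕ) (hn : 1 ≤ n) :
    ∃ ℓ : ℕ, ℓ ≤ n ∧
      ∃ (α : Fin ℓ → ℝ) (β : Fin ℓ → ℤ),
        (∀ i, 0 < α i) ∧ (∀ i, -1 ≤ β i) ∧
        ∀ x : ℤ, x ≤ (n : ℤ) - 1 →
          p x = ∑ i, max 0 (α i * (((x - β i : ℤ) : ℝ))) := by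
  classical
  set c : ℕ → ℝ := fun j => p j - 2 * p (j - 1) + p (j - 2)
  set S := (Finset.range n).filter fun j => 0 < c j with hS
  have hmem : ∀ i, (S.equivFin.symm i : ℕ) ∈ S := fun i => (S.equivFin.symm i).2
  refine ⟨S.card, (Finset.card_filter_le _ _).trans (Finset.card_range n).le,
    fun i => c (S.equivFin.symm i), fun i => ((S.equivFin.symm i : ℕ) : ℤ) - 1,
    fun i => (Finset.mem_filter.mp (hmem i)).2, fun i => by dsimp only; omega, fun x hx => ?_⟩
  rw [eq_sum_hinge_secondDifference p hconv hzero n x hx,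
    S.equivFin.symm.sum_comp fun j : S => max 0 (c j * ((x - (((j : ℕ) : ℤ) - 1) : ℤ) : ℝ)),
    Finset.sum_coe_sort S fun j : ℕ => max 0 (c j * ((x - ((j : ℤ) - 1) : ℤ) : ℝ)), hS]
  refine (Finset.sum_filter_of_ne fun j _ hne => ?_).symm
  by_contra hnot
  have hconvj := hconv ((j : ℤ) - 1)
  rw [sub_sub, sub_add_cancel] at hconvj
  norm_num at hconvj
  have : p j - 2 * p (j - 1) + p (j - 2) = 0 := le_antisymm (not_lt.mp hnot) (by linarith)
  exact hne (by rw [this, zero_mul, max_self])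
end

section
/- Let G = (V, E, w) be a finite weighted directed graph with n = |V|, and let p : ℤ → ℝ be nondecreasing with p(x) = 0 for all x < 0. Then for every rank assignment r : V → ℤ there exists a rank assignment r' : V → {0, …, n − 1} with q(G, r', p) ≤ q(G, r, p); consequently, the minimum of q(G, ·, p) over rank assignments with values in {0, …, n − 1} equals the infimum of q(G, ·, p) over all integer-valued rank assignments. -/
/-- The score of a rank assignment `r` on a weighted directed graph `(V, E, w)` for a
penalty function `p`: `∑_{(u,v) ∈ E} w (u,v) * p (r u - r v)`. -/
def scoreOf {V : Type*} (E : Finset (V × V)) (w : V × V → ℝ) (p : ℤ → ℝ)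
    (r : V → ℤ) : ℝ :=
  ∑ e ∈ E, w e * p (r e.1 - r e.2)

/-- The number of elements of `S` strictly below `x`. -/
def countBelow (S : Finset ℤ) (x : ℤ) : ℕ :=
  (S.filter (· < x)).card

theorem countBelow_lt_card {S : Finset ℤ} {x : ℤ} (hx : x ∈ S) :
    countBelow S x < S.card :=
  Finset.card_lt_card (Finset.filter_ssubset.2 ⟨x, hx, lt_irrefl x⟩)

theorem countBelow_lt_countBelow {S : Finset ℤ} {x y : ℤ} (hx : x ∈ S) (hxy : x < y) :
    countBelow S x < countBelow S y := by
  refine Finset.card_lt_card (Finset.ssubset_iff_of_subset ?_ |>.2 ⟨x, ?_, ?_⟩)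
  · intro z hz
    rw [Finset.mem_filter] at hz ⊢
    exact ⟨hz.1, hz.2.trans hxy⟩
  · simp [hx, hxy]
  · simp

theorem countBelow_sub_le {S : Finset ℤ} {x y : ℤ} (hyx : y ≤ x) :
    (countBelow S x : ℤ) - countBelow S y ≤ x - y := by
  have hsub : S.filter (· < x) ⊆ S.filter (· < y) ∪ Finset.Ico y x := by
    intro z hz
    simp only [Finset.mem_union, Finset.mem_filter, Finset.mem_Ico] at hz ⊢
    rcases lt_or_ge z y with h | h
    · exact Or.inl ⟨hz.1, h⟩
    · exact Or.inr ⟨h, hz.2⟩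
  have hcard := (Finset.card_le_card hsub).trans (Finset.card_union_le _ _)
  rw [Int.card_Ico] at hcard
  unfold countBelow
  omega

theorem penalty_countBelow_le {p : ℤ → ℝ} (hmono : Monotone p)
    (hzero : ∀ x : ℤ, x < 0 → p x = 0) {S : Finset ℤ} {x y : ℤ} (hx : x ∈ S) :
    p ((countBelow S x : ℤ) - countBelow S y) ≤ p (x - y) := by
  rcases lt_or_ge x y with h | h
  · have hlt := countBelow_lt_countBelow hx h
    rw [hzero _ (by omega), hzero _ (by omega)]
  · exact hmono (countBelow_sub_le h)

theorem exists_bounded_scoreOf_le {V : Type*} [Fintype V]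
    (E : Finset (V × V)) (w : V × V → ℝ) (hw : ∀ e ∈ E, 0 ≤ w e)
    (p : ℤ → ℝ) (hmono : Monotone p) (hzero : ∀ x : ℤ, x < 0 → p x = 0) (r : V → ℤ) :
    ∃ r' : V → ℤ, (∀ v, 0 ≤ r' v ∧ r' v ≤ (Fintype.card V : ℤ) - 1) ∧
      scoreOf E w p r' ≤ scoreOf E w p r := by
  have hmem (v : V) : r v ∈ Finset.univ.image r :=
    Finset.mem_image_of_mem r (Finset.mem_univ v)
  refine ⟨fun v => countBelow (Finset.univ.image r) (r v), fun v => ⟨by positivity, ?_⟩, ?_⟩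
  · have hlt := countBelow_lt_card (hmem v)
    have hle : (Finset.univ.image r).card ≤ Fintype.card V := Finset.card_image_le
    dsimp only
    omega
  · exact Finset.sum_le_sum fun e he =>
      mul_le_mul_of_nonneg_left (penalty_countBelow_le hmono hzero (hmem e.1)) (hw e he)

/-- for a nondecreasing penalty `p` vanishing on negative integers,
every rank assignment can be replaced by one with values in `{0, …, n-1}` without
increasing the score; consequently the minimum over assignments with values in
`{0, …, n-1}` is attained and equals the infimum over all integer assignments. -/
theorem compress_ranks
    {V : Type*} [Fintype V]
    (E : Finset (V × V)) (w : V × V → ℝ) (hw : ∀ e ∈ E, 0 < w e)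
    (p : ℤ → ℝ) (hmono : Monotone p) (hzero : ∀ x : ℤ, x < 0 → p x = 0) :
    (∀ r : V → ℤ, ∃ r' : V → ℤ,
      (∀ v, 0 ≤ r' v ∧ r' v ≤ (Fintype.card V : ℤ) - 1) ∧
      scoreOf E w p r' ≤ scoreOf E w p r) ∧
    (∃ r₀ : V → ℤ,
      (∀ v, 0 ≤ r₀ v ∧ r₀ v ≤ (Fintype.card V : ℤ) - 1) ∧
      ∀ r : V → ℤ, scoreOf E w p r₀ ≤ scoreOf E w p r) := by
  have hcompress := exists_bounded_scoreOf_le E w (fun e he => (hw e he).le) p hmono hzero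
  refine ⟨hcompress, ?_⟩
  have hfin : {r : V → ℤ | ∀ v, 0 ≤ r v ∧ r v ≤ (Fintype.card V : ℤ) - 1}.Finite :=
    Set.Finite.pi' fun _ => Set.finite_Icc (0 : ℤ) ((Fintype.card V : ℤ) - 1)
  obtain ⟨r₁, hr₁, -⟩ := hcompress 0
  obtain ⟨r₀, hr₀, hmin⟩ := Set.exists_min_image _ (scoreOf E w p) hfin ⟨r₁, hr₁⟩
  refine ⟨r₀, hr₀, fun r => ?_⟩
  obtain ⟨r', hr', hle⟩ := hcompress r
  exact (hmin r' hr').trans hle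
end

section
/- Let G = (V, E, w) be a finite weighted directed graph with n = |V|, and let p_const be the constant penalty, p_const(d) = 1 if d ≥ 0 and p_const(d) = 0 otherwise. Then there exists an injective rank assignment r : V → {0, …, n − 1} (each vertex receives its own rank) such that q(G, r, p_const) equals the minimum of q(G, ·, p_const) over all rank assignments with values in {0, …, n − 1}. -/
/-- The constant penalty: `1` on nonnegative integers, `0` on negative ones. -/
def pconst (d : ℤ) : ℝ := if 0 ≤ d then 1 else 0

theorem pconst_le_pconst {a b : ℤ} (h : b < 0 → a < 0) : pconst a ≤ pconst b := by
  unfold pconst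
  split_ifs with ha hb hb
  · exact le_rfl
  · exact absurd (h (not_le.mp hb)) (not_lt.mpr ha)
  · exact zero_le_one
  · exact le_rfl

/-- Refining the strict order induced by a rank assignment does not increase the score. -/
theorem scoreOf_pconst_le_of_refines {V : Type*} {E : Finset (V × V)} {w : V × V → ℝ}
    (hw : ∀ e ∈ E, 0 ≤ w e) {r r' : V → ℤ} (h : ∀ u v, r' u < r' v → r u < r v) :
    scoreOf E w pconst r ≤ scoreOf E w pconst r' :=
  Finset.sum_le_sum fun e he => mul_le_mul_of_nonneg_left
    (pconst_le_pconst fun hlt => sub_neg.mpr (h _ _ (sub_neg.mp hlt))) (hw e he)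

/-- Every map to a linear order is refined by some enumeration of its finite domain. -/
theorem exists_equiv_fin_refines {V α : Type*} [Fintype V] [LinearOrder α] (f : V → α) :
    ∃ σ : V ≃ Fin (Fintype.card V), ∀ u v, f u < f v → σ u < σ v := by
  let e := Fintype.equivFin V
  let τ := Tuple.sort (f ∘ e.symm)
  refine ⟨e.trans τ.symm, fun u v huv => ?_⟩
  contrapose! huv
  simpa [τ] using Tuple.monotone_sort (f ∘ e.symm) huv

/-- for the constant penalty there is always an injective optimal rank
assignment into `{0, …, n-1}` (each vertex gets its own rank). -/
theorem pconst_injective_minimizer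
    {V : Type*} [Fintype V]
    (E : Finset (V × V)) (w : V × V → ℝ) (hw : ∀ e ∈ E, 0 < w e) :
    ∃ r : V → ℤ, Function.Injective r ∧
      (∀ v, 0 ≤ r v ∧ r v ≤ (Fintype.card V : ℤ) - 1) ∧
      ∀ r' : V → ℤ, (∀ v, 0 ≤ r' v ∧ r' v ≤ (Fintype.card V : ℤ) - 1) →
        scoreOf E w pconst r ≤ scoreOf E w pconst r' := by
  have : Nonempty (V ≃ Fin (Fintype.card V)) := ⟨Fintype.equivFin V⟩
  obtain ⟨σ, hσ⟩ := Finite.exists_min fun σ : V ≃ Fin (Fintype.card V) =>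
    scoreOf E w pconst fun v => ((σ v : ℕ) : ℤ)
  refine ⟨fun v => ((σ v : ℕ) : ℤ), fun u v huv => ?_, fun v => ?_, fun r' _ => ?_⟩
  · exact σ.injective (Fin.ext (Nat.cast_injective huv))
  · have := (σ v).isLt
    dsimp only
    omega
  · obtain ⟨τ, hτ⟩ := exists_equiv_fin_refines r'
    exact (hσ τ).trans <| scoreOf_pconst_le_of_refines (fun e he => (hw e he).le)
      fun u v huv => Nat.cast_lt.mpr (hτ u v huv)
end
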